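/- Let n ≥ 2, M = 2, let X ⊆ {0,1}^n be the set of strings whose Hamming weight is 0 or ⌊n/2⌋, and define f : X → Bool by f x = false if x is the all-zeros string and f x = true otherwise. Then D(f) ≥ ⌊n/2⌋ + 1 while R(f) ≤ 3. -/

import Mathlib

open scoped Classical

namespace QCPaper

/-- A partial assignment `c` is consistent with the input `x` if it agrees with `x`
wherever it is defined. -/
def Consistent {n M : ℕ} (c : Fin n → Option (Fin M)) (x : Fin n → Fin M) : Prop :=
  ∀ i : Fin n, ∀ a : Fin M, c i = some a → x i = a

/-- The size of a partial assignment: the number of indices where it is defined. -/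
def paSize {n M : ℕ} (c : Fin n → Option (Fin M)) : ℕ :=
  (Finset.univ.filter fun i => c i ≠ none).card

/-- `c` is a certificate for the partial function `f` with promise `X`:
all inputs in `X` consistent with `c` get the same value under `f`. -/
def IsCertificate {n M : ℕ} (X : Set (Fin n → Fin M)) (f : (Fin n → Fin M) → Bool)
    (c : Fin n → Option (Fin M)) : Prop :=
  ∀ x ∈ X, ∀ y ∈ X, Consistent c x → Consistent c y → f x = f y

/-- The certificate complexity of `f` at the input `x`:
the least size of a certificate for `f` consistent with `x`. -/
noncomputable def Cx {n M : ℕ} (X : Set (Fin n → Fin M)) (f : (Fin n → Fin M) → Bool)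
    (x : Fin n → Fin M) : ℕ :=
  sInf {k | ∃ c : Fin n → Option (Fin M),
    IsCertificate X f c ∧ Consistent c x ∧ paSize c = k}

/-- The certificate complexity `C(f)`: the maximum of `Cx` over inputs in the promise. -/
noncomputable def certC {n M : ℕ} (X : Set (Fin n → Fin M))
    (f : (Fin n → Fin M) → Bool) : ℕ :=
  sSup {k | ∃ x ∈ X, Cx X f x = k}

/-- `b` is a sensitive block of `x` for `f` (with promise `X`). -/
def SensBlock {n M : ℕ} (X : Set (Fin n → Fin M)) (f : (Fin n → Fin M) → Bool)
    (x : Fin n → Fin M) (b : Finset (Fin n)) : Prop :=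
  ∃ y ∈ X, f y ≠ f x ∧ ∀ i : Fin n, y i ≠ x i → i ∈ b

/-- The block sensitivity of `f` at `x`: the largest number of pairwise disjoint
sensitive blocks of `x`. -/
noncomputable def bsx {n M : ℕ} (X : Set (Fin n → Fin M)) (f : (Fin n → Fin M) → Bool)
    (x : Fin n → Fin M) : ℕ :=
  sSup {m | ∃ b : Fin m → Finset (Fin n),
    (∀ j, SensBlock X f x (b j)) ∧ ∀ j j', j ≠ j' → Disjoint (b j) (b j')}

/-- The block sensitivity `bs(f)`. -/
noncomputable def bs {n M : ℕ} (X : Set (Fin n → Fin M))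
    (f : (Fin n → Fin M) → Bool) : ℕ :=
  sSup {m | ∃ x ∈ X, bsx X f x = m}

/-- The sensitivity of `f` at `x`: the largest number of pairwise disjoint
sensitive blocks of `x`, each of size 2. -/
noncomputable def sx {n M : ℕ} (X : Set (Fin n → Fin M)) (f : (Fin n → Fin M) → Bool)
    (x : Fin n → Fin M) : ℕ :=
  sSup {m | ∃ b : Fin m → Finset (Fin n),
    (∀ j, SensBlock X f x (b j) ∧ (b j).card = 2) ∧ ∀ j j', j ≠ j' → Disjoint (b j) (b j')}

/-- The sensitivity `s(f)`. -/
noncomputable def sens {n M : ℕ} (X : Set (Fin n → Fin M))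
    (f : (Fin n → Fin M) → Bool) : ℕ :=
  sSup {m | ∃ x ∈ X, sx X f x = m}

/-- The type of an input: the multiset of its entries. -/
def typeOf {n M : ℕ} (x : Fin n → Fin M) : Multiset (Fin M) :=
  Finset.univ.val.map x

/-- The multiplicity of the alphabet element `a` in the input `x`. -/
def mult {n M : ℕ} (x : Fin n → Fin M) (a : Fin M) : ℕ :=
  (Finset.univ.filter fun i => x i = a).card

/-- A type promise: the (nonempty) set of all strings with one fixed type. -/
def IsTypePromise {n M : ℕ} (T : Set (Fin n → Fin M)) : Prop :=
  ∃ x₀ : Fin n → Fin M, T = {x | typeOf x = typeOf x₀}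

/-- Decision trees over `[M]^n`: either a leaf with a Boolean answer, or a query
to an index together with a subtree for each possible answer. -/
inductive DTree (n M : ℕ) : Type
  | leaf : Bool → DTree n M
  | node : Fin n → (Fin M → DTree n M) → DTree n M

/-- Evaluation of a decision tree on an input. -/
def DTree.eval {n M : ℕ} : DTree n M → (Fin n → Fin M) → Bool
  | .leaf b, _ => b
  | .node i ts, x => (ts (x i)).eval x

/-- The cost of a decision tree on an input: the number of queries made. -/
def DTree.cost {n M : ℕ} : DTree n M → (Fin n → Fin M) → ℕ
  | .leaf _, _ => 0
  | .node i ts, x => (ts (x i)).cost x + 1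

/-- The depth of a decision tree: its maximum cost over all inputs. -/
def DTree.depth {n M : ℕ} : DTree n M → ℕ
  | .leaf _ => 0
  | .node _ ts => (Finset.univ.sup fun a => (ts a).depth) + 1

/-- The tree `t` computes `f` on the promise `X`. -/
def Computes {n M : ℕ} (X : Set (Fin n → Fin M)) (f : (Fin n → Fin M) → Bool)
    (t : DTree n M) : Prop :=
  ∀ x ∈ X, t.eval x = f x

/-- The deterministic query complexity `D(f)`:
the least depth of a decision tree computing `f`. -/
noncomputable def detD {n M : ℕ} (X : Set (Fin n → Fin M))
    (f : (Fin n → Fin M) → Bool) : ℕ :=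
  sInf {d | ∃ t : DTree n M, Computes X f t ∧ t.depth = d}

/-- A finitely supported probability distribution over decision trees,
given as a finite list of trees with probabilities. -/
structure RandAlg (n M : ℕ) where
  N : ℕ
  tree : Fin N → DTree n M
  prob : Fin N → ℝ
  nonneg : ∀ j, 0 ≤ prob j
  sum_one : ∑ j, prob j = 1

/-- The expected cost of a randomized algorithm on the input `x`. -/
noncomputable def expCost {n M : ℕ} (A : RandAlg n M) (x : Fin n → Fin M) : ℝ :=
  ∑ j, A.prob j * ((A.tree j).cost x : ℝ)

/-- `A` is a zero-error randomized algorithm for `f`: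
every tree in its support computes `f`. -/
def ZeroError {n M : ℕ} (X : Set (Fin n → Fin M)) (f : (Fin n → Fin M) → Bool)
    (A : RandAlg n M) : Prop :=
  ∀ j, A.prob j ≠ 0 → Computes X f (A.tree j)

/-- The cost of a randomized algorithm: the maximum over inputs in the promise of
the expected cost. -/
noncomputable def algCost {n M : ℕ} (X : Set (Fin n → Fin M)) (A : RandAlg n M) : ℝ :=
  sSup {r | ∃ x ∈ X, r = expCost A x}

/-- The zero-error randomized query complexity `R₀(f)`:
the infimum cost of a zero-error randomized algorithm for `f`. -/
noncomputable def R0 {n M : ℕ} (X : Set (Fin n → Fin M))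
    (f : (Fin n → Fin M) → Bool) : ℝ :=
  sInf {r | ∃ A : RandAlg n M, ZeroError X f A ∧ algCost X A = r}

/-- `A` is a bounded-error randomized algorithm for `f`: on every input in the promise,
it returns the correct answer with probability at least 2/3. -/
def BoundedError {n M : ℕ} (X : Set (Fin n → Fin M)) (f : (Fin n → Fin M) → Bool)
    (A : RandAlg n M) : Prop :=
  ∀ x ∈ X, (2/3 : ℝ) ≤ ∑ j ∈ Finset.univ.filter fun j => (A.tree j).eval x = f x, A.prob j

/-- The depth of a randomized algorithm: the maximum depth of a tree in its support. -/
noncomputable def suppDepth {n M : ℕ} (A : RandAlg n M) : ℕ :=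
  (Finset.univ.filter fun j => A.prob j ≠ 0).sup fun j => (A.tree j).depth

/-- The bounded-error randomized query complexity `R(f)`:
the least depth of a bounded-error randomized algorithm for `f`. -/
noncomputable def randR {n M : ℕ} (X : Set (Fin n → Fin M))
    (f : (Fin n → Fin M) → Bool) : ℕ :=
  sInf {d | ∃ A : RandAlg n M, BoundedError X f A ∧ suppDepth A = d}

/-- A set of inputs is symmetric if it is invariant under permuting coordinates. -/
def SymmetricSet {n M : ℕ} (X : Set (Fin n → Fin M)) : Prop :=
  ∀ x ∈ X, ∀ σ : Equiv.Perm (Fin n), (x ∘ σ) ∈ X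

/-- A function is symmetric if its value depends only on the type of the input. -/
def SymmetricFun {n M : ℕ} (X : Set (Fin n → Fin M))
    (f : (Fin n → Fin M) → Bool) : Prop :=
  ∀ x ∈ X, ∀ y ∈ X, typeOf x = typeOf y → f x = f y

/-- The measure `d(f)` for a non-constant symmetric function: the least distance between
the types of two inputs in the promise with different values under `f`. -/
noncomputable def dgap {n M : ℕ} (X : Set (Fin n → Fin M))
    (f : (Fin n → Fin M) → Bool) : ℕ :=
  sInf {d | ∃ x ∈ X, ∃ y ∈ X, f x ≠ f y ∧
    (Finset.univ.sup fun a => Nat.dist (mult x a) (mult y a)) = d}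

/-- The decision tree that queries the listed indices in order, answering `true` as soon
as it sees a `1`. -/
def orTree {n : ℕ} : List (Fin n) → DTree n 2
  | [] => .leaf false
  | i :: l => .node i fun a => if a = 1 then .leaf true else orTree l

theorem orTree_eval {n : ℕ} (l : List (Fin n)) (x : Fin n → Fin 2) :
    (orTree l).eval x = true ↔ ∃ i ∈ l, x i = 1 := by
  induction l with
  | nil => simp [orTree, DTree.eval]
  | cons i l ih =>
    by_cases h : x i = 1
    · simp [orTree, DTree.eval, h]
    · simp [orTree, DTree.eval, h, ih]

theorem orTree_depth_le {n : ℕ} (l : List (Fin n)) : (orTree l).depth ≤ l.length := by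
  induction l with
  | nil => simp [orTree, DTree.depth]
  | cons i l ih =>
    simp only [orTree, DTree.depth, List.length_cons, add_le_add_iff_right]
    refine Finset.sup_le fun a _ => ?_
    split_ifs
    · simp [DTree.depth]
    · exact ih

/-- A tree only looks at `t.depth` coordinates of an input `y`, so it cannot distinguish `y`
from an input agreeing with it there. -/
theorem DTree.exists_card_le_depth {n M : ℕ} (t : DTree n M) (y : Fin n → Fin M) :
    ∃ S : Finset (Fin n), S.card ≤ t.depth ∧
      ∀ x : Fin n → Fin M, (∀ i ∈ S, x i = y i) → t.eval x = t.eval y := by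
  induction t with
  | leaf b => exact ⟨∅, by simp, fun _ _ => rfl⟩
  | node i ts ih =>
    obtain ⟨S, hS, h⟩ := ih (y i)
    refine ⟨insert i S, ?_, fun x hx => ?_⟩
    · have h_sup : (ts (y i)).depth ≤ Finset.univ.sup fun a => (ts a).depth :=
        Finset.le_sup (f := fun a => (ts a).depth) (Finset.mem_univ _)
      have h_ins := Finset.card_insert_le i S
      simp only [DTree.depth]
      omega
    · simp only [DTree.eval]
      rw [hx i (Finset.mem_insert_self _ _)]
      exact h x fun j hj => hx j (Finset.mem_insert_of_mem hj)

theorem ne_zero_iff_exists_eq_one {n : ℕ} (x : Fin n → Fin 2) :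
    (x ≠ fun _ => 0) ↔ ∃ i, x i = 1 := by
  rw [Function.ne_iff]
  exact exists_congr fun i => by generalize x i = a; revert a; decide

/-- The algorithm running `orTree` on `q` uniformly random indices, drawn with replacement. -/
noncomputable def sampleAlg (n q : ℕ) (hn : n ≠ 0) : RandAlg n 2 where
  N := n ^ q
  tree j := orTree (List.ofFn (finFunctionFinEquiv.symm j))
  prob _ := ((n : ℝ) ^ q)⁻¹
  nonneg _ := by positivity
  sum_one := by
    have : (n : ℝ) ^ q ≠ 0 := by positivity
    simp [this]

theorem suppDepth_sampleAlg_le (n q : ℕ) (hn : n ≠ 0) : suppDepth (sampleAlg n q hn) ≤ q := by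
  refine Finset.sup_le fun j _ => (orTree_depth_le _).trans ?_
  simp

theorem card_sampleAlg_miss (n q : ℕ) (hn : n ≠ 0) (x : Fin n → Fin 2) :
    (Finset.univ.filter fun j => ¬ ((sampleAlg n q hn).tree j).eval x = true).card
      = (n - mult x 1) ^ q := by
  have h_compl : (Finset.univ.filter fun i => ¬ x i = 1).card = n - mult x 1 := by
    have h := Finset.card_filter_add_card_filter_not (s := (Finset.univ : Finset (Fin n)))
      (fun i => x i = 1)
    rw [Finset.card_univ, Fintype.card_fin] at h
    unfold mult
    omega
  rw [← h_compl, ← Fintype.card_piFinset_const]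
  refine Finset.card_equiv finFunctionFinEquiv.symm fun j => ?_
  rw [Finset.mem_filter, Fintype.mem_piFinset, and_iff_right (Finset.mem_univ j)]
  simp only [sampleAlg, orTree_eval, List.mem_ofFn,
    exists_exists_eq_and, not_exists, Finset.mem_filter, Finset.mem_univ, true_and]
  rfl

theorem sampleAlg_success (n q : ℕ) (hn : n ≠ 0) (x : Fin n → Fin 2) :
    ∑ j ∈ Finset.univ.filter fun j => ((sampleAlg n q hn).tree j).eval x = true,
      (sampleAlg n q hn).prob j = 1 - (((n - mult x 1 : ℕ) : ℝ) / n) ^ q := by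
  have h := Finset.sum_filter_add_sum_filter_not Finset.univ
    (fun j => ((sampleAlg n q hn).tree j).eval x = true) (sampleAlg n q hn).prob
  rw [(sampleAlg n q hn).sum_one] at h
  have h_miss : ∑ j ∈ Finset.univ.filter fun j => ¬ ((sampleAlg n q hn).tree j).eval x = true,
      (sampleAlg n q hn).prob j = (((n - mult x 1 : ℕ) : ℝ) / n) ^ q := by
    have h_const : (sampleAlg n q hn).prob = fun _ => ((n : ℝ) ^ q)⁻¹ := rfl
    rw [h_const, Finset.sum_const, card_sampleAlg_miss, nsmul_eq_mul, div_pow, div_eq_mul_inv]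
    push_cast
    rfl
  linarith

theorem boundedError_sampleAlg (n : ℕ) (hn : 2 ≤ n) :
    BoundedError {x : Fin n → Fin 2 | mult x 1 = 0 ∨ mult x 1 = n / 2}
      (fun x => decide (x ≠ fun _ => (0 : Fin 2))) (sampleAlg n 3 (Nat.ne_zero_of_lt hn)) := by
  intro x hx
  by_cases h0 : x = fun _ => 0
  · have h_all : ∀ j, ((sampleAlg n 3 (Nat.ne_zero_of_lt hn)).tree j).eval x
        = decide (x ≠ fun _ => (0 : Fin 2)) := by
      intro j
      rw [Bool.eq_iff_iff, decide_eq_true_iff, ne_zero_iff_exists_eq_one]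
      simp [sampleAlg, orTree_eval, h0]
    rw [Finset.filter_true_of_mem fun j _ => h_all j, RandAlg.sum_one]
    norm_num
  · have h_dec : decide (x ≠ fun _ => (0 : Fin 2)) = true := decide_eq_true h0
    simp only [h_dec]
    rw [sampleAlg_success]
    have h_pos : mult x 1 ≠ 0 := by
      obtain ⟨i, hi⟩ := (ne_zero_iff_exists_eq_one x).1 h0
      exact Finset.card_ne_zero_of_mem (Finset.mem_filter.2 ⟨Finset.mem_univ i, hi⟩)
    have h_half : mult x 1 = n / 2 := hx.resolve_left h_pos
    have h_le : 3 * ((n - mult x 1 : ℕ) : ℝ) ≤ 2 * n := by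
      have : 3 * (n - mult x 1) ≤ 2 * n := by omega
      exact_mod_cast this
    have h_frac : ((n - mult x 1 : ℕ) : ℝ) / n ≤ 2 / 3 := by
      rw [div_le_div_iff₀ (by positivity) (by norm_num)]
      linarith
    have h_cube : (((n - mult x 1 : ℕ) : ℝ) / n) ^ 3 ≤ (2 / 3) ^ 3 := by gcongr
    norm_num at h_cube ⊢
    linarith

theorem computes_orTree_finRange {n : ℕ} (X : Set (Fin n → Fin 2)) :
    Computes X (fun x => decide (x ≠ fun _ => (0 : Fin 2))) (orTree (List.finRange n)) := by
  intro x _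
  rw [Bool.eq_iff_iff, decide_eq_true_iff, ne_zero_iff_exists_eq_one, orTree_eval]
  simp

theorem half_lt_depth_of_computes {n : ℕ} (hn : 2 ≤ n) (t : DTree n 2)
    (ht : Computes {x : Fin n → Fin 2 | mult x 1 = 0 ∨ mult x 1 = n / 2}
      (fun x => decide (x ≠ fun _ => (0 : Fin 2))) t) :
    n / 2 < t.depth := by
  by_contra! h_depth
  obtain ⟨S, hS, h_eval⟩ := t.exists_card_le_depth fun _ => 0
  obtain ⟨T, hTS, hT⟩ : ∃ T ⊆ Sᶜ, T.card = n / 2 := by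
    refine Finset.exists_subset_card_eq ?_
    rw [Finset.card_compl, Fintype.card_fin]
    omega
  let x : Fin n → Fin 2 := fun i => if i ∈ T then 1 else 0
  have hx_mult : mult x 1 = n / 2 := by
    rw [← hT]
    simp [mult, x]
  have hx_ne : x ≠ fun _ => 0 := by
    obtain ⟨i, hi⟩ := Finset.card_pos.1 (show 0 < T.card by omega)
    exact (ne_zero_iff_exists_eq_one x).2 ⟨i, by simp [x, hi]⟩
  have h_same := h_eval x fun i hi =>
    if_neg fun hiT => Finset.mem_compl.1 (hTS hiT) hi
  rw [ht x (Or.inr hx_mult), ht (fun _ => 0) (Or.inl (by simp [mult]))] at h_same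
  simp [hx_ne] at h_same

/-- for the promise of binary strings of Hamming weight `0` or `⌊n/2⌋`
and `f` deciding whether the input is not all-zeros, `D(f) ≥ ⌊n/2⌋ + 1` while
`R(f) ≤ 3`. -/
theorem detD_large_randR_small (n : ℕ) (hn : 2 ≤ n) :
    n / 2 + 1 ≤
      detD {x : Fin n → Fin 2 | mult x 1 = 0 ∨ mult x 1 = n / 2}
        (fun x => decide (x ≠ fun _ => (0 : Fin 2))) ∧
    randR {x : Fin n → Fin 2 | mult x 1 = 0 ∨ mult x 1 = n / 2}
        (fun x => decide (x ≠ fun _ => (0 : Fin 2))) ≤ 3 := by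
  constructor
  · refine le_csInf ⟨_, _, computes_orTree_finRange _, rfl⟩ ?_
    rintro d ⟨t, ht, rfl⟩
    exact half_lt_depth_of_computes hn t ht
  · refine le_trans (Nat.sInf_le ?_) (suppDepth_sampleAlg_le n 3 (Nat.ne_zero_of_lt hn))
    exact ⟨_, boundedError_sampleAlg n hn, rfl⟩

end QCPaper
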